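/- Assume φ* belongs to a linear subspace 𝓗 of H. Then φ* is the unique minimizer of the self-test loss 𝓔 over 𝓗 if and only if for every nonzero φ ∈ 𝓗 there exists l ∈ {1,…,L} with ⟨R_l φ, v_l φ⟩ > 0 (equivalently, ∑_{l=1}^L ⟨R_l φ, v_l φ⟩ > 0 for every nonzero φ ∈ 𝓗). -/

import Mathlib

open scoped BigOperators

/-- The self-test loss function `𝓔(φ) = ∑_l (⟨R_l φ, v_l φ⟩ − 2⟨f_l, v_l φ⟩) + C₀`
with `f_l = R_l φ*` and `C₀ = ∑_l ⟨R_l φ*, v_l φ*⟩`, where the dual pairing is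
`⟨y, ξ⟩ = ξ y`. -/
noncomputable def selfTestLoss {H Y : Type*} [AddCommGroup H] [Module ℝ H]
    [NormedAddCommGroup Y] [NormedSpace ℝ Y]
    (L : ℕ) (R : Fin L → H →ₗ[ℝ] Y) (v : Fin L → H →ₗ[ℝ] (Y →L[ℝ] ℝ))
    (φs φ : H) : ℝ :=
  (∑ l, (v l φ (R l φ) - 2 * v l φ (R l φs))) + ∑ l, v l φs (R l φs)

theorem selfTestLoss_eq_sum_sub {H Y : Type*} [AddCommGroup H] [Module ℝ H]
    [NormedAddCommGroup Y] [NormedSpace ℝ Y]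
    (L : ℕ) (R : Fin L → H →ₗ[ℝ] Y) (v : Fin L → H →ₗ[ℝ] (Y →L[ℝ] ℝ))
    (hsymm : ∀ (l : Fin L) (φ ψ : H), v l ψ (R l φ) = v l φ (R l ψ)) (φs φ : H) :
    selfTestLoss L R v φs φ = ∑ l, v l (φ - φs) (R l (φ - φs)) := by
  rw [selfTestLoss, ← Finset.sum_add_distrib]
  refine Finset.sum_congr rfl fun l _ => ?_
  simp only [map_sub, sub_apply]
  linarith [hsymm l φ φs]

/-- φ* is the unique minimizer of the self-test loss over the linear subspace 𝓗
iff for every nonzero φ ∈ 𝓗 there is an `l` with `⟨R_l φ, v_l φ⟩ > 0`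
(equivalently, `∑_l ⟨R_l φ, v_l φ⟩ > 0` for every nonzero φ ∈ 𝓗). -/
theorem stmt1 {H Y : Type*} [AddCommGroup H] [Module ℝ H]
    [NormedAddCommGroup Y] [NormedSpace ℝ Y]
    (L : ℕ) (R : Fin L → H →ₗ[ℝ] Y) (v : Fin L → H →ₗ[ℝ] (Y →L[ℝ] ℝ))
    (hsymm : ∀ (l : Fin L) (φ ψ : H), v l ψ (R l φ) = v l φ (R l ψ))
    (hpos : ∀ (l : Fin L) (φ : H), 0 ≤ v l φ (R l φ))
    (𝓗 : Submodule ℝ H) (φs : H) (hφs : φs ∈ 𝓗) :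
    (((∀ φ ∈ 𝓗, selfTestLoss L R v φs φs ≤ selfTestLoss L R v φs φ) ∧
        (∀ φ ∈ 𝓗, selfTestLoss L R v φs φ = selfTestLoss L R v φs φs → φ = φs)) ↔
      (∀ φ ∈ 𝓗, φ ≠ 0 → ∃ l : Fin L, 0 < v l φ (R l φ))) ∧
    (((∀ φ ∈ 𝓗, selfTestLoss L R v φs φs ≤ selfTestLoss L R v φs φ) ∧
        (∀ φ ∈ 𝓗, selfTestLoss L R v φs φ = selfTestLoss L R v φs φs → φ = φs)) ↔
      (∀ φ ∈ 𝓗, φ ≠ 0 → 0 < ∑ l, v l φ (R l φ))) := by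
  have hloss := selfTestLoss_eq_sum_sub L R v hsymm φs
  have hloss_self : selfTestLoss L R v φs φs = 0 := by simp [hloss]
  have hnonneg : ∀ φ, 0 ≤ ∑ l, v l φ (R l φ) := fun φ =>
    Finset.sum_nonneg fun l _ => hpos l φ
  have hsum : ∀ φ, 0 < ∑ l, v l φ (R l φ) ↔ ∃ l : Fin L, 0 < v l φ (R l φ) := fun φ => by
    simpa using Finset.sum_pos_iff_of_nonneg (s := Finset.univ) fun l _ => hpos l φ
  simp only [← hsum, and_self]
  constructor
  · rintro ⟨-, huniq⟩ φ hφ hne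
    refine (hnonneg φ).lt_of_ne fun h0 => hne ?_
    have h := huniq (φ + φs) (𝓗.add_mem hφ hφs) (by
      rw [hloss_self, hloss, add_sub_cancel_right, ← h0])
    simpa using h
  · refine fun h => ⟨fun φ _ => ?_, fun φ hφ heq => ?_⟩
    · rw [hloss_self, hloss]
      exact hnonneg _
    · by_contra hne
      have hlt := h (φ - φs) (𝓗.sub_mem hφ hφs) (sub_ne_zero.mpr hne)
      rw [← hloss, heq, hloss_self] at hlt
      exact hlt.false
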